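/- With D_{p^m} the full localization of the Weyl algebra A_n(W_{m,p}) over the m-truncated Witt ring, let K_m = W_{m,p}(x_i^{p^m}, y_i^{p^m} : 1 ≤ i ≤ n) be the ring of fractions P/Q with P, Q polynomials in the x_i^{p^m}, y_i^{p^m} and Q nonzero modulo p. Then the center Z_m of D_{p^m} is generated as a K_m-module by the elements v_{α,β} = p^{m - s(α,β)} (∏ x_i^{α_i})(∏ y_i^{β_i}) with 0 ≤ α_i, β_i ≤ p^m − 1 and s(α,β) > 0, where s(α,β) is the largest integer s with p^s dividing all α_i and β_i; moreover each v_{α,β} satisfies the relation p^{s(α,β)} v_{α,β} = 0 and these are the defining relations. -/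

import Mathlib

/-- The defining relations of the `n`-th Weyl algebra over `F`:
`x_i x_j = x_j x_i`, `y_i y_j = y_j y_i`, `y_i x_j = x_j y_i + δ_{ij}`. -/
inductive WeylRel (F : Type*) [CommRing F] (n : ℕ) :
    FreeAlgebra F (Fin n ⊕ Fin n) → FreeAlgebra F (Fin n ⊕ Fin n) → Prop
  | xx (i j : Fin n) : WeylRel F n
      (FreeAlgebra.ι F (Sum.inl i) * FreeAlgebra.ι F (Sum.inl j))
      (FreeAlgebra.ι F (Sum.inl j) * FreeAlgebra.ι F (Sum.inl i))
  | yy (i j : Fin n) : WeylRel F n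
      (FreeAlgebra.ι F (Sum.inr i) * FreeAlgebra.ι F (Sum.inr j))
      (FreeAlgebra.ι F (Sum.inr j) * FreeAlgebra.ι F (Sum.inr i))
  | yx (i j : Fin n) : WeylRel F n
      (FreeAlgebra.ι F (Sum.inr i) * FreeAlgebra.ι F (Sum.inl j))
      (FreeAlgebra.ι F (Sum.inl j) * FreeAlgebra.ι F (Sum.inr i) + if i = j then 1 else 0)

/-- The `n`-th Weyl algebra `A_n(F)`. -/
def WeylAlgebra (F : Type*) [CommRing F] (n : ℕ) := RingQuot (WeylRel F n)

noncomputable instance (F : Type*) [CommRing F] (n : ℕ) : Ring (WeylAlgebra F n) :=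
  inferInstanceAs (Ring (RingQuot (WeylRel F n)))

noncomputable instance (F : Type*) [CommRing F] (n : ℕ) : Algebra F (WeylAlgebra F n) :=
  inferInstanceAs (Algebra F (RingQuot (WeylRel F n)))

/-- The generator `x_i` of the Weyl algebra. -/
noncomputable def WeylAlgebra.X {F : Type*} [CommRing F] {n : ℕ} (i : Fin n) : WeylAlgebra F n :=
  RingQuot.mkAlgHom F (WeylRel F n) (FreeAlgebra.ι F (Sum.inl i))

/-- The generator `y_i` of the Weyl algebra. -/
noncomputable def WeylAlgebra.Y {F : Type*} [CommRing F] {n : ℕ} (i : Fin n) : WeylAlgebra F n :=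
  RingQuot.mkAlgHom F (WeylRel F n) (FreeAlgebra.ι F (Sum.inr i))

/-- The `m`-truncated Witt ring `W_{m,p} = W(k)/(p^m)`. -/
def TruncWitt (p : ℕ) [Fact p.Prime] (k : Type*) [CommRing k] (m : ℕ) :=
  WittVector p k ⧸ Ideal.span {(p : WittVector p k) ^ m}

noncomputable instance (p : ℕ) [Fact p.Prime] (k : Type*) [CommRing k] (m : ℕ) :
    CommRing (TruncWitt p k m) :=
  inferInstanceAs (CommRing (WittVector p k ⧸ Ideal.span {(p : WittVector p k) ^ m}))

/-- The `i`-th graded piece `qⁱR / qⁱ⁺¹R` of the filtration of `R` by powers of `q`. -/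
def grPiece (D : Type*) [Ring D] (q : D) (i : ℕ) : Type _ :=
  ↥(AddMonoidHom.mulLeft (q ^ i)).range ⧸
    ((AddMonoidHom.mulLeft (q ^ (i + 1))).range.addSubgroupOf
      (AddMonoidHom.mulLeft (q ^ i)).range)

noncomputable instance (D : Type*) [Ring D] (q : D) (i : ℕ) : AddCommGroup (grPiece D q i) :=
  inferInstanceAs (AddCommGroup (_ ⧸ _))

/-- The class of `a ∈ qⁱR` in the graded piece `qⁱR/qⁱ⁺¹R`. -/
def grMk (D : Type*) [Ring D] (q : D) (i : ℕ) (a : D)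
    (ha : a ∈ (AddMonoidHom.mulLeft (q ^ i)).range) : grPiece D q i :=
  QuotientAddGroup.mk ⟨a, ha⟩

/-- The full localization of the Weyl algebra `A_n(F)` at the Ore set of
non-zero-divisors. -/
abbrev WeylLoc (F : Type*) [CommRing F] (n : ℕ)
    [OreLocalization.OreSet (nonZeroDivisors (WeylAlgebra F n))] :=
  OreLocalization (nonZeroDivisors (WeylAlgebra F n)) (WeylAlgebra F n)

/-- The smallest subring of `D` containing `S` and closed under taking (two-sided)
inverses of its elements; for `S` a set of "polynomials" this is the corresponding
ring of fractions `P/Q` inside `D`. -/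
def divClosure {D : Type*} [Ring D] (S : Set D) : Subring D :=
  sInf {T : Subring D | S ⊆ T ∧ ∀ x ∈ T, ∀ y : D, x * y = 1 → y * x = 1 → y ∈ T}

/-- `s(α,β)`: the largest integer `s ≤ m` such that `p^s` divides all `αᵢ` and `βᵢ`. -/
def sExp (p m : ℕ) {n : ℕ} (α β : Fin n → ℕ) : ℕ :=
  Nat.findGreatest (fun s => ∀ i, p ^ s ∣ α i ∧ p ^ s ∣ β i) m

section
variable (p n m : ℕ) [Fact p.Prime] (k : Type*) [Field k] [IsAlgClosed k] [CharP k p]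
  [OreLocalization.OreSet (nonZeroDivisors (WeylAlgebra (TruncWitt p k m) n))]

/-- The image of the generator `xᵢ` in `D_{pᵐ}`. -/
noncomputable def wx (i : Fin n) : WeylLoc (TruncWitt p k m) n :=
  OreLocalization.numeratorRingHom (WeylAlgebra.X i)

/-- The image of the generator `yᵢ` in `D_{pᵐ}`. -/
noncomputable def wy (i : Fin n) : WeylLoc (TruncWitt p k m) n :=
  OreLocalization.numeratorRingHom (WeylAlgebra.Y i)

/-- `K_m ⊆ D_{pᵐ}`: the ring `W_{m,p}(xᵢ^{pᵐ}, yᵢ^{pᵐ})` of rational functions in the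
`pᵐ`-th powers of the generators, realized as the inverse-closed subring of `D_{pᵐ}`
generated by the scalars `W_{m,p}` and the `xᵢ^{pᵐ}`, `yᵢ^{pᵐ}`. -/
noncomputable def Km : Subring (WeylLoc (TruncWitt p k m) n) :=
  divClosure (Set.range (algebraMap (TruncWitt p k m) (WeylLoc (TruncWitt p k m) n)) ∪
    Set.range (fun i : Fin n => wx p n m k i ^ p ^ m) ∪
    Set.range (fun i : Fin n => wy p n m k i ^ p ^ m))

/-- The element `v_{α,β} = p^{m-s(α,β)} (∏ xᵢ^{αᵢ}) (∏ yᵢ^{βᵢ})` of `D_{pᵐ}`. -/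
noncomputable def vElt (α β : Fin n → Fin (p ^ m)) : WeylLoc (TruncWitt p k m) n :=
  (p : WeylLoc (TruncWitt p k m) n) ^ (m - sExp p m (fun i => (α i : ℕ)) (fun i => (β i : ℕ))) *
    (List.ofFn fun i : Fin n => wx p n m k i ^ (α i : ℕ)).prod *
    (List.ofFn fun i : Fin n => wy p n m k i ^ (β i : ℕ)).prod


section PBW

open MvPolynomial

open scoped IsMulCommutative in
theorem exists_algHom_of_commute {R A ι : Type*} [CommRing R] [Ring A] [Algebra R A] (g : ι → A)
    (hg : ∀ i j, g i * g j = g j * g i) :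
    ∃ φ : MvPolynomial ι R →ₐ[R] A, ∀ i, φ (X i) = g i := by
  have hcomm : ∀ a ∈ Set.range g, ∀ b ∈ Set.range g, a * b = b * a := by
    rintro _ ⟨i, rfl⟩ _ ⟨j, rfl⟩
    exact hg i j
  have := Algebra.isMulCommutative_adjoin R hcomm
  let g' : ι → Algebra.adjoin R (Set.range g) :=
    fun i => ⟨g i, Algebra.subset_adjoin (Set.mem_range_self i)⟩
  exact ⟨(Algebra.adjoin R (Set.range g)).val.comp (aeval g'), fun i => by simp [g']⟩

namespace WeylAlgebra

variable {F : Type*} [CommRing F] {n : ℕ}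

theorem X_mul_X (i j : Fin n) : (X i * X j : WeylAlgebra F n) = X j * X i := by
  have := RingQuot.mkAlgHom_rel F (WeylRel.xx (F := F) i j)
  rw [map_mul, map_mul] at this
  exact this

theorem Y_mul_Y (i j : Fin n) : (Y i * Y j : WeylAlgebra F n) = Y j * Y i := by
  have := RingQuot.mkAlgHom_rel F (WeylRel.yy (F := F) i j)
  rw [map_mul, map_mul] at this
  exact this

theorem Y_mul_X (i j : Fin n) :
    (Y i * X j : WeylAlgebra F n) = X j * Y i + if i = j then 1 else 0 := by
  have := RingQuot.mkAlgHom_rel F (WeylRel.yx (F := F) i j)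
  rw [map_add, map_mul, map_mul] at this
  refine this.trans ?_
  congr 1
  split_ifs
  · exact map_one _
  · exact map_zero _

theorem induction_on {M : WeylAlgebra F n → Prop} (a : WeylAlgebra F n)
    (hC : ∀ r : F, M (algebraMap F _ r)) (hX : ∀ i, M (X i)) (hY : ∀ i, M (Y i))
    (hadd : ∀ a b, M a → M b → M (a + b)) (hmul : ∀ a b, M a → M b → M (a * b)) : M a := by
  obtain ⟨b, rfl⟩ := RingQuot.mkAlgHom_surjective F (WeylRel F n) a
  induction b using FreeAlgebra.induction with
  | grade0 r => rw [AlgHom.commutes]; exact hC r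
  | grade1 x => rcases x with i | i; exacts [hX i, hY i]
  | mul a b ha hb => rw [map_mul]; exact hmul _ _ ha hb
  | add a b ha hb => rw [map_add]; exact hadd _ _ ha hb

/-- An element of the Weyl algebra is central iff it commutes with all generators. -/
theorem mem_center_iff {a : WeylAlgebra F n} :
    a ∈ Subring.center (WeylAlgebra F n) ↔ (∀ i, a * X i = X i * a) ∧ ∀ i, a * Y i = Y i * a := by
  rw [Subring.mem_center_iff]
  refine ⟨fun h => ⟨fun i => (h _).symm, fun i => (h _).symm⟩, fun h b => ?_⟩
  induction b using induction_on with
  | hC r => exact Algebra.commutes r a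
  | hX i => exact (h.1 i).symm
  | hY i => exact (h.2 i).symm
  | hadd b c hb hc => rw [add_mul, mul_add, hb, hc]
  | hmul b c hb hc => rw [mul_assoc, hc, ← mul_assoc, hb, mul_assoc]

/-- The embedding of the polynomials in the `x_i`. -/
noncomputable def xHom : MvPolynomial (Fin n) F →ₐ[F] WeylAlgebra F n :=
  (exists_algHom_of_commute _ X_mul_X).choose

/-- The embedding of the polynomials in the `y_i`. -/
noncomputable def yHom : MvPolynomial (Fin n) F →ₐ[F] WeylAlgebra F n :=
  (exists_algHom_of_commute _ Y_mul_Y).choose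

@[simp] theorem xHom_X (i : Fin n) : xHom (MvPolynomial.X i : MvPolynomial (Fin n) F) = X i :=
  (exists_algHom_of_commute _ X_mul_X).choose_spec i

@[simp] theorem yHom_X (i : Fin n) : yHom (MvPolynomial.X i : MvPolynomial (Fin n) F) = Y i :=
  (exists_algHom_of_commute _ Y_mul_Y).choose_spec i

theorem Y_mul_xHom (i : Fin n) (f : MvPolynomial (Fin n) F) :
    Y i * xHom f = xHom f * Y i + xHom (pderiv i f) := by
  induction f using MvPolynomial.induction_on with
  | C r => simp [← MvPolynomial.algebraMap_eq, Algebra.commutes]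
  | add f g hf hg => simp only [map_add, mul_add, add_mul, hf, hg]; abel
  | mul_X f j hf =>
    rw [map_mul, ← mul_assoc, hf, add_mul, mul_assoc, xHom_X, Y_mul_X, pderiv_mul, map_add,
      map_mul, map_mul, xHom_X, pderiv_X, Pi.single_apply, mul_add, mul_assoc]
    split_ifs with h h' h'
    · simp only [map_one]; abel
    · exact absurd h.symm h'
    · exact absurd h'.symm h
    · simp only [map_zero]; abel

theorem yHom_mul_X (i : Fin n) (g : MvPolynomial (Fin n) F) :
    yHom g * X i = X i * yHom g + yHom (pderiv i g) := by
  induction g using MvPolynomial.induction_on with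
  | C r => simp [← MvPolynomial.algebraMap_eq, Algebra.commutes]
  | add f g hf hg => simp only [map_add, mul_add, add_mul, hf, hg]; abel
  | mul_X f j hf =>
    rw [map_mul, mul_assoc, yHom_X, Y_mul_X, mul_add, ← mul_assoc, hf, add_mul, pderiv_mul, map_add,
      map_mul, map_mul, yHom_X, pderiv_X, Pi.single_apply, mul_assoc]
    split_ifs
    · simp only [map_one]; abel
    · simp only [map_zero]; abel

/-- The normal ordering map, sending the monomial `x^α y^β` to the ordered product
`X^α Y^β` in the Weyl algebra. -/
noncomputable def ordered : MvPolynomial (Fin n ⊕ Fin n) F →ₗ[F] WeylAlgebra F n :=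
  (basisMonomials (Fin n ⊕ Fin n) F).constr F fun e =>
    xHom (monomial (Finsupp.sumFinsuppEquivProdFinsupp e).1 (1 : F)) *
      yHom (monomial (Finsupp.sumFinsuppEquivProdFinsupp e).2 1)

theorem ordered_monomial (e : Fin n ⊕ Fin n →₀ ℕ) (r : F) :
    ordered (monomial e r) = r • (xHom (monomial (Finsupp.sumFinsuppEquivProdFinsupp e).1 1) *
      yHom (monomial (Finsupp.sumFinsuppEquivProdFinsupp e).2 1)) := by
  have := (basisMonomials (Fin n ⊕ Fin n) F).constr_basis F (fun e =>
    xHom (monomial (Finsupp.sumFinsuppEquivProdFinsupp e).1 (1 : F)) *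
      yHom (monomial (Finsupp.sumFinsuppEquivProdFinsupp e).2 1)) e
  rw [coe_basisMonomials] at this
  rw [← mul_one r, ← smul_eq_mul, ← smul_monomial, map_smul, smul_eq_mul, mul_one]
  exact congrArg (r • ·) this

theorem induction_on_rename {M : MvPolynomial (Fin n ⊕ Fin n) F → Prop}
    (h : ∀ f g : MvPolynomial (Fin n) F, M (rename Sum.inl f * rename Sum.inr g))
    (hadd : ∀ a b, M a → M b → M (a + b)) (a : MvPolynomial (Fin n ⊕ Fin n) F) : M a := by
  induction a using MvPolynomial.induction_on' with
  | monomial e r =>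
    convert h (monomial (Finsupp.sumFinsuppEquivProdFinsupp e).1 r)
      (monomial (Finsupp.sumFinsuppEquivProdFinsupp e).2 1) using 1
    rw [rename_monomial, rename_monomial, monomial_mul, mul_one]
    refine congrArg (fun d => monomial d r) (Finsupp.ext ?_)
    rintro (i | i)
    · simp [Finsupp.mapDomain_apply Sum.inl_injective, Finsupp.mapDomain_of_notMem_range]
    · simp [Finsupp.mapDomain_apply Sum.inr_injective, Finsupp.mapDomain_of_notMem_range]
  | add p q hp hq => exact hadd _ _ hp hq

theorem ordered_rename_mul_rename (f g : MvPolynomial (Fin n) F) :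
    ordered (rename Sum.inl f * rename Sum.inr g) = xHom f * yHom g := by
  induction f using MvPolynomial.induction_on' with
  | add p q hp hq => simp only [map_add, add_mul, hp, hq]
  | monomial a r =>
    induction g using MvPolynomial.induction_on' with
    | add p q hp hq => simp only [map_add, mul_add, hp, hq]
    | monomial b s =>
      rw [rename_monomial, rename_monomial, monomial_mul, ordered_monomial]
      have h1 : (Finsupp.sumFinsuppEquivProdFinsupp
          (a.mapDomain Sum.inl + b.mapDomain Sum.inr)).1 = a := by
        ext i
        simp [Finsupp.mapDomain_apply Sum.inl_injective, Finsupp.mapDomain_of_notMem_range]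
      have h2 : (Finsupp.sumFinsuppEquivProdFinsupp
          (a.mapDomain Sum.inl + b.mapDomain Sum.inr)).2 = b := by
        ext i
        simp [Finsupp.mapDomain_apply Sum.inr_injective, Finsupp.mapDomain_of_notMem_range]
      rw [h1, h2, show monomial a r = r • monomial a (1 : F) by simp [smul_monomial],
        show monomial b s = s • monomial b (1 : F) by simp [smul_monomial], map_smul, map_smul,
        smul_mul_smul_comm]

theorem X_mul_ordered (i : Fin n) (f : MvPolynomial (Fin n ⊕ Fin n) F) :
    X i * ordered f = ordered (MvPolynomial.X (Sum.inl i) * f) := by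
  induction f using induction_on_rename with
  | h f g =>
    rw [ordered_rename_mul_rename, ← mul_assoc, ← mul_assoc, ← rename_X Sum.inl, ← map_mul,
      ordered_rename_mul_rename, map_mul, xHom_X]
  | hadd a b ha hb => simp only [map_add, mul_add, ha, hb]

theorem ordered_mul_Y (i : Fin n) (f : MvPolynomial (Fin n ⊕ Fin n) F) :
    ordered f * Y i = ordered (f * MvPolynomial.X (Sum.inr i)) := by
  induction f using induction_on_rename with
  | h f g =>
    rw [ordered_rename_mul_rename, mul_assoc, mul_assoc, ← rename_X Sum.inr, ← map_mul,
      ordered_rename_mul_rename, map_mul, yHom_X]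
  | hadd a b ha hb => simp only [map_add, add_mul, ha, hb]

theorem pderiv_inl_rename_inr (i : Fin n) (g : MvPolynomial (Fin n) F) :
    pderiv (Sum.inl i) (rename Sum.inr g : MvPolynomial (Fin n ⊕ Fin n) F) = 0 := by
  induction g using MvPolynomial.induction_on with
  | C r => simp
  | add f g hf hg => simp [hf, hg]
  | mul_X f j hf => simp [hf]

theorem pderiv_inr_rename_inl (i : Fin n) (g : MvPolynomial (Fin n) F) :
    pderiv (Sum.inr i) (rename Sum.inl g : MvPolynomial (Fin n ⊕ Fin n) F) = 0 := by
  induction g using MvPolynomial.induction_on with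
  | C r => simp
  | add f g hf hg => simp [hf, hg]
  | mul_X f j hf => simp [hf]

theorem Y_mul_ordered (i : Fin n) (f : MvPolynomial (Fin n ⊕ Fin n) F) :
    Y i * ordered f = ordered (MvPolynomial.X (Sum.inr i) * f + pderiv (Sum.inl i) f) := by
  induction f using induction_on_rename with
  | h f g =>
    rw [pderiv_mul, pderiv_rename Sum.inl_injective, pderiv_inl_rename_inr, mul_zero, add_zero,
      mul_left_comm, ← rename_X Sum.inr, ← map_mul, map_add, ordered_rename_mul_rename,
      ordered_rename_mul_rename, ordered_rename_mul_rename, ← mul_assoc, Y_mul_xHom, map_mul,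
      yHom_X, add_mul, mul_assoc]
  | hadd a b ha hb => simp only [map_add, mul_add, ha, hb]; abel

theorem ordered_mul_X (i : Fin n) (f : MvPolynomial (Fin n ⊕ Fin n) F) :
    ordered f * X i = ordered (f * MvPolynomial.X (Sum.inl i) + pderiv (Sum.inr i) f) := by
  induction f using induction_on_rename with
  | h f g =>
    rw [pderiv_mul, pderiv_rename Sum.inr_injective, pderiv_inr_rename_inl, zero_mul, zero_add,
      mul_right_comm, ← rename_X Sum.inl, ← map_mul, map_add, ordered_rename_mul_rename,
      ordered_rename_mul_rename, ordered_rename_mul_rename, mul_assoc, yHom_mul_X, map_mul,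
      xHom_X, mul_add, mul_assoc]
  | hadd a b ha hb => simp only [map_add, add_mul, ha, hb]; abel

theorem ordered_one : ordered (1 : MvPolynomial (Fin n ⊕ Fin n) F) = 1 := by
  simpa using ordered_rename_mul_rename (1 : MvPolynomial (Fin n) F) 1

theorem pderiv_comm {σ : Type*} (i j : σ) (f : MvPolynomial σ F) :
    pderiv i (pderiv j f) = pderiv j (pderiv i f) := by
  classical
  have : ⁅pderiv (R := F) i, pderiv (R := F) j⁆ = 0 := by
    refine MvPolynomial.derivation_ext fun k => ?_
    rw [Derivation.commutator_apply, pderiv_X, pderiv_X, Pi.single_apply, Pi.single_apply]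
    split_ifs <;> simp
  have := DFunLike.congr_fun this f
  simpa [Derivation.commutator_apply, sub_eq_zero] using this

/-- The action of the generators of the Weyl algebra on polynomials in `x` and `y`:
`x_i` acts by multiplication and `y_i` by `y_i + ∂/∂x_i`. -/
noncomputable def actGen : Fin n ⊕ Fin n → Module.End F (MvPolynomial (Fin n ⊕ Fin n) F)
  | Sum.inl i => LinearMap.mulLeft F (MvPolynomial.X (Sum.inl i))
  | Sum.inr i => LinearMap.mulLeft F (MvPolynomial.X (Sum.inr i)) +
      (pderiv (Sum.inl i)).toLinearMap

theorem lift_actGen_eq ⦃a b : FreeAlgebra F (Fin n ⊕ Fin n)⦄ (h : WeylRel F n a b) :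
    FreeAlgebra.lift F (actGen (F := F)) a = FreeAlgebra.lift F (actGen (F := F)) b := by
  induction h with
  | xx i j =>
    refine LinearMap.ext fun f => ?_
    simp [actGen]
    ring
  | yy i j =>
    refine LinearMap.ext fun f => ?_
    simp [actGen, pderiv_comm (Sum.inl i)]
    ring
  | yx i j =>
    refine LinearMap.ext fun f => ?_
    by_cases h : i = j
    · subst h
      simp [actGen]
      ring
    · have h' : (Sum.inl j : Fin n ⊕ Fin n) ≠ Sum.inl i := fun e => h (Sum.inl_injective e).symm
      simp [actGen, h, pderiv_X_of_ne h']
      ring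

/-- The faithful action of the Weyl algebra on polynomials in `x` and `y`. -/
noncomputable def act : WeylAlgebra F n →ₐ[F] Module.End F (MvPolynomial (Fin n ⊕ Fin n) F) :=
  RingQuot.liftAlgHom F ⟨FreeAlgebra.lift F actGen, lift_actGen_eq⟩

theorem act_X (i : Fin n) (f : MvPolynomial (Fin n ⊕ Fin n) F) :
    act (X i) f = MvPolynomial.X (Sum.inl i) * f := by
  have h := RingQuot.liftAlgHom_mkAlgHom_apply F (FreeAlgebra.lift F (actGen (F := F) (n := n)))
    lift_actGen_eq (FreeAlgebra.ι F (Sum.inl i))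
  rw [FreeAlgebra.lift_ι_apply] at h
  exact LinearMap.congr_fun h f

theorem act_Y (i : Fin n) (f : MvPolynomial (Fin n ⊕ Fin n) F) :
    act (Y i) f = MvPolynomial.X (Sum.inr i) * f + pderiv (Sum.inl i) f := by
  have h := RingQuot.liftAlgHom_mkAlgHom_apply F (FreeAlgebra.lift F (actGen (F := F) (n := n)))
    lift_actGen_eq (FreeAlgebra.ι F (Sum.inr i))
  rw [FreeAlgebra.lift_ι_apply] at h
  exact LinearMap.congr_fun h f

theorem ordered_act (a : WeylAlgebra F n) (f : MvPolynomial (Fin n ⊕ Fin n) F) :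
    ordered (act a f) = a * ordered f := by
  induction a using induction_on generalizing f with
  | hC r => rw [AlgHom.commutes, Module.algebraMap_end_apply, map_smul, Algebra.smul_def]
  | hX i => rw [act_X, X_mul_ordered]
  | hY i => rw [act_Y, Y_mul_ordered]
  | hadd a b ha hb => simp [ha, hb, add_mul]
  | hmul a b ha hb => simp [ha, hb, mul_assoc]

theorem act_xHom (f : MvPolynomial (Fin n) F) (g : MvPolynomial (Fin n ⊕ Fin n) F) :
    act (xHom f) g = rename Sum.inl f * g := by
  induction f using MvPolynomial.induction_on generalizing g with
  | C r => simp [← MvPolynomial.algebraMap_eq, Algebra.smul_def]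
  | add f g hf hg => simp [hf, hg, add_mul]
  | mul_X f j hf => simp [hf, act_X, mul_assoc]

theorem act_yHom_one (f g : MvPolynomial (Fin n) F) :
    act (yHom f) (rename Sum.inr g) = rename Sum.inr (f * g) := by
  induction f using MvPolynomial.induction_on generalizing g with
  | C r => simp [← MvPolynomial.algebraMap_eq, Algebra.smul_def]
  | add f g hf hg => simp [hf, hg, add_mul]
  | mul_X f j hf =>
    rw [map_mul, map_mul, Module.End.mul_apply, yHom_X, act_Y, pderiv_inl_rename_inr, add_zero,
      ← rename_X Sum.inr, ← map_mul, hf, mul_assoc]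

theorem act_ordered (f : MvPolynomial (Fin n ⊕ Fin n) F) : act (ordered f) 1 = f := by
  induction f using induction_on_rename with
  | h f g =>
    rw [ordered_rename_mul_rename, map_mul, Module.End.mul_apply, act_xHom,
      ← map_one (rename Sum.inr), act_yHom_one, mul_one]
  | hadd a b ha hb => simp only [map_add, LinearMap.add_apply, ha, hb]

/-- The Poincaré–Birkhoff–Witt theorem for the Weyl algebra: normal ordering is bijective. -/
noncomputable def orderedEquiv : MvPolynomial (Fin n ⊕ Fin n) F ≃ₗ[F] WeylAlgebra F n :=
  LinearEquiv.ofBijective ordered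
    ⟨Function.LeftInverse.injective (g := fun a => act a 1) act_ordered,
      fun a => ⟨act a 1, by rw [ordered_act, ordered_one, mul_one]⟩⟩

theorem ordered_injective :
    Function.Injective (ordered : MvPolynomial (Fin n ⊕ Fin n) F → WeylAlgebra F n) :=
  orderedEquiv.injective

theorem ordered_surjective :
    Function.Surjective (ordered : MvPolynomial (Fin n ⊕ Fin n) F → WeylAlgebra F n) :=
  orderedEquiv.surjective

end WeylAlgebra
end PBW

section Expand

open MvPolynomial

variable {σ F : Type*} [Fintype σ] [CommRing F] {q : ℕ}

/-- The exponent vector with the given entries, all smaller than `q`. -/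
noncomputable def residue (r : σ → Fin q) : σ →₀ ℕ :=
  Finsupp.equivFunOnFinite.symm fun j => (r j : ℕ)

@[simp] theorem residue_apply (r : σ → Fin q) (j : σ) : residue r j = r j := rfl

theorem exists_eq_smul_add_residue (hq : 0 < q) (e : σ →₀ ℕ) :
    ∃ (d : σ →₀ ℕ) (r : σ → Fin q), e = q • d + residue r :=
  ⟨Finsupp.equivFunOnFinite.symm fun j => e j / q, fun j => ⟨e j % q, Nat.mod_lt _ hq⟩,
    Finsupp.ext fun j => by simp [Nat.div_add_mod]⟩

theorem coeff_expand_mul_monomial_residue (hq : 0 < q) (f : MvPolynomial σ F)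
    (d : σ →₀ ℕ) (r : σ → Fin q) :
    coeff (q • d + residue r) (expand q f * monomial (residue r) 1) = coeff d f := by
  rw [coeff_mul_monomial, mul_one, coeff_expand_smul q hq.ne']

theorem coeff_expand_mul_monomial_residue_of_ne (f : MvPolynomial σ F)
    (d : σ →₀ ℕ) {r r' : σ → Fin q} (h : r ≠ r') :
    coeff (q • d + residue r) (expand q f * monomial (residue r') 1) = 0 := by
  classical
  rw [coeff_mul_monomial']
  split_ifs with hle
  · obtain ⟨j, hj⟩ := Function.ne_iff.mp h
    rw [coeff_expand_of_not_dvd (i := j), zero_mul]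
    intro hdvd
    apply hj
    have h1 : (r' j : ℕ) ≤ q * d j + r j := by simpa using hle j
    have h2 : q ∣ q * d j + r j - r' j := by simpa using hdvd
    have h3 := (Nat.modEq_iff_dvd' h1).mpr h2
    rw [Nat.ModEq, Nat.mul_add_mod, Nat.mod_eq_of_lt (r' j).2, Nat.mod_eq_of_lt (r j).2] at h3
    exact Fin.ext h3.symm
  · rfl

theorem coeff_sum_expand_mul_monomial (hq : 0 < q) (c : (σ → Fin q) → MvPolynomial σ F)
    (d : σ →₀ ℕ) (r : σ → Fin q) [Fintype (σ → Fin q)] :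
    coeff (q • d + residue r) (∑ r', expand q (c r') * monomial (residue r') 1) =
      coeff d (c r) := by
  rw [coeff_sum, Finset.sum_eq_single r, coeff_expand_mul_monomial_residue hq]
  · exact fun r' _ h => coeff_expand_mul_monomial_residue_of_ne _ _ h.symm
  · exact fun h => absurd (Finset.mem_univ r) h

theorem exists_eq_sum_expand_mul_monomial (hq : 0 < q) [Fintype (σ → Fin q)]
    (f : MvPolynomial σ F) :
    ∃ c : (σ → Fin q) → MvPolynomial σ F,
      f = ∑ r, expand q (c r) * monomial (residue r) 1 := by
  classical
  induction f using MvPolynomial.induction_on' with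
  | monomial e a =>
    obtain ⟨d, r, rfl⟩ := exists_eq_smul_add_residue hq e
    refine ⟨Pi.single r (monomial d a), ?_⟩
    rw [Finset.sum_eq_single r]
    · simp [expand_monomial, monomial_mul]
    · intro r' _ h
      simp [h]
    · exact fun h => absurd (Finset.mem_univ r) h
  | add f g hf hg =>
    obtain ⟨c, rfl⟩ := hf
    obtain ⟨d, rfl⟩ := hg
    exact ⟨c + d, by simp [add_mul, Finset.sum_add_distrib]⟩

end Expand

section RegularMultiplication

theorem exists_mul_eq_algebraMap_of_basis {R A ι : Type*} [CommRing R] [Ring A] [Algebra R A]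
    [Fintype ι] (B : Module.Basis ι R A) {s : A} (hs : ∀ a, a * s = 0 → a = 0) :
    ∃ b : A, ∃ t ∈ nonZeroDivisors R, b * s = algebraMap R A t := by
  classical
  let M := LinearMap.toMatrix B B (LinearMap.mulRight R s)
  have hM : M.det ∈ nonZeroDivisors R := by
    rw [← Matrix.nonsingular_iff_det_mem_nonZeroDivisors]
    apply Matrix.Nonsingular.of_linearIndependent_col
    rw [← Matrix.mulVec_injective_iff, ← Matrix.coe_mulVecLin, ← LinearMap.ker_eq_bot,
      LinearMap.ker_eq_bot']
    intro v hv
    have h1 : LinearMap.mulRight R s (B.equivFun.symm v) = 0 := by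
      apply B.equivFun.injective
      have := LinearMap.toMatrix_mulVec_repr B B (LinearMap.mulRight R s) (B.equivFun.symm v)
      rw [map_zero, Module.Basis.equivFun_apply, ← this, ← Module.Basis.equivFun_apply,
        LinearEquiv.apply_symm_apply]
      exact hv
    have h2 := hs _ h1
    rwa [LinearEquiv.map_eq_zero_iff] at h2
  refine ⟨Matrix.toLin B B M.adjugate 1, M.det, hM, ?_⟩
  have h : LinearMap.mulRight R s = Matrix.toLin B B M := (Matrix.toLin_toMatrix B B _).symm
  calc Matrix.toLin B B M.adjugate 1 * s
      = LinearMap.mulRight R s (Matrix.toLin B B M.adjugate 1) := rfl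
    _ = (Matrix.toLin B B M ∘ₗ Matrix.toLin B B M.adjugate) 1 := by rw [h]; rfl
    _ = algebraMap R A M.det := by
      rw [← Matrix.toLin_mul, Matrix.mul_adjugate, map_smul, Matrix.toLin_one,
        LinearMap.smul_apply, LinearMap.id_apply, Algebra.algebraMap_eq_smul_one]

theorem algebraMap_mem_nonZeroDivisors_of_basis {R A ι : Type*} [CommRing R] [Ring A] [Algebra R A]
    (B : Module.Basis ι R A) {t : R} (ht : t ∈ nonZeroDivisors R) :
    algebraMap R A t ∈ nonZeroDivisors A := by
  have key (a : A) (h : algebraMap R A t * a = 0) : a = 0 := by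
    refine B.ext_elem fun i => ?_
    rw [← Algebra.smul_def] at h
    have := congrArg (fun a => B.repr a i) h
    simp only [map_smul, Finsupp.smul_apply, smul_eq_mul, map_zero, Finsupp.zero_apply] at this
    rw [map_zero, Finsupp.zero_apply]
    exact (mul_left_mem_nonZeroDivisors_eq_zero_iff ht).mp this
  exact ⟨key, fun a h => key a (by rwa [Algebra.commutes])⟩

end RegularMultiplication

namespace WeylAlgebra

open MvPolynomial

variable {F : Type*} [CommRing F] {n : ℕ}

theorem Y_mul_ordered_eq_iff (i : Fin n) (f : MvPolynomial (Fin n ⊕ Fin n) F) :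
    ordered f * Y i = Y i * ordered f ↔ pderiv (Sum.inl i) f = 0 := by
  rw [ordered_mul_Y, Y_mul_ordered, ordered_injective.eq_iff, mul_comm, left_eq_add]

theorem X_mul_ordered_eq_iff (i : Fin n) (f : MvPolynomial (Fin n ⊕ Fin n) F) :
    ordered f * X i = X i * ordered f ↔ pderiv (Sum.inr i) f = 0 := by
  rw [ordered_mul_X, X_mul_ordered, ordered_injective.eq_iff, mul_comm, add_eq_left]

theorem ordered_mem_center_iff (f : MvPolynomial (Fin n ⊕ Fin n) F) :
    ordered f ∈ Subring.center (WeylAlgebra F n) ↔ ∀ j, pderiv j f = 0 := by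
  simp only [mem_center_iff, Y_mul_ordered_eq_iff, X_mul_ordered_eq_iff, Sum.forall]
  exact and_comm

theorem X_pow_mul_ordered (i : Fin n) (q : ℕ) (f : MvPolynomial (Fin n ⊕ Fin n) F) :
    X i ^ q * ordered f = ordered (MvPolynomial.X (Sum.inl i) ^ q * f) := by
  induction q generalizing f with
  | zero => simp
  | succ q ih => rw [pow_succ, pow_succ, mul_assoc, X_mul_ordered, ih, mul_assoc]

theorem ordered_mul_Y_pow (i : Fin n) (q : ℕ) (f : MvPolynomial (Fin n ⊕ Fin n) F) :
    ordered f * Y i ^ q = ordered (f * MvPolynomial.X (Sum.inr i) ^ q) := by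
  induction q generalizing f with
  | zero => simp
  | succ q ih => rw [pow_succ', pow_succ', ← mul_assoc, ordered_mul_Y, ih, mul_assoc]

/-- The `q`-th powers of the generators. -/
noncomputable def genPow (q : ℕ) : Fin n ⊕ Fin n → WeylAlgebra F n
  | Sum.inl i => X i ^ q
  | Sum.inr i => Y i ^ q

theorem genPow_eq_ordered (q : ℕ) (j : Fin n ⊕ Fin n) :
    (genPow q j : WeylAlgebra F n) = ordered (MvPolynomial.X j ^ q) := by
  rcases j with i | i
  · have := X_pow_mul_ordered i q (1 : MvPolynomial (Fin n ⊕ Fin n) F)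
    rwa [ordered_one, mul_one, mul_one] at this
  · have := ordered_mul_Y_pow i q (1 : MvPolynomial (Fin n ⊕ Fin n) F)
    rwa [ordered_one, one_mul, one_mul] at this

theorem genPow_mem_center {q : ℕ} (hq : (q : F) = 0) (j : Fin n ⊕ Fin n) :
    (genPow q j : WeylAlgebra F n) ∈ Subring.center (WeylAlgebra F n) := by
  have : ((q : ℕ) : MvPolynomial (Fin n ⊕ Fin n) F) = 0 := by
    rw [← map_natCast (C : F →+* _), hq, map_zero]
  rw [genPow_eq_ordered, ordered_mem_center_iff]
  intro k
  rw [pderiv_pow, this, zero_mul, zero_mul]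

theorem exists_powHom {q : ℕ} (hq : (q : F) = 0) :
    ∃ φ : MvPolynomial (Fin n ⊕ Fin n) F →ₐ[F] WeylAlgebra F n,
      ∀ j, φ (MvPolynomial.X j) = genPow q j :=
  exists_algHom_of_commute _ fun i j =>
    Subring.mem_center_iff.mp (genPow_mem_center hq j) (genPow q i)

/-- The homomorphism from polynomials onto the central subalgebra generated by the `q`-th
powers of the generators, when `q = 0` in the base ring. -/
noncomputable def powHom {q : ℕ} (hq : (q : F) = 0) :
    MvPolynomial (Fin n ⊕ Fin n) F →ₐ[F] WeylAlgebra F n :=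
  (exists_powHom hq).choose

variable {q : ℕ} (hq : (q : F) = 0)

theorem powHom_X (j : Fin n ⊕ Fin n) : powHom hq (MvPolynomial.X j) = genPow q j :=
  (exists_powHom hq).choose_spec j

theorem powHom_mem_center (c : MvPolynomial (Fin n ⊕ Fin n) F) :
    powHom hq c ∈ Subring.center (WeylAlgebra F n) := by
  induction c using MvPolynomial.induction_on with
  | C r =>
    rw [← MvPolynomial.algebraMap_eq, AlgHom.commutes, Subring.mem_center_iff]
    exact fun a => (Algebra.commutes r a).symm
  | add c d hc hd => rw [map_add]; exact add_mem hc hd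
  | mul_X c j hc => rw [map_mul, powHom_X]; exact mul_mem hc (genPow_mem_center hq j)

theorem powHom_mul_ordered (c f : MvPolynomial (Fin n ⊕ Fin n) F) :
    powHom hq c * ordered f = ordered (expand q c * f) := by
  induction c using MvPolynomial.induction_on generalizing f with
  | C r =>
    rw [expand_C, ← MvPolynomial.algebraMap_eq, AlgHom.commutes, ← Algebra.smul_def,
      ← Algebra.smul_def, map_smul]
  | add c d hc hd => simp only [map_add, add_mul, hc, hd]
  | mul_X c j hc =>
    rw [map_mul (powHom hq), map_mul (expand q), mul_assoc, mul_assoc, ← hc, powHom_X, expand_X]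
    congr 1
    rcases j with i | i
    · exact X_pow_mul_ordered i q f
    · rw [← Subring.mem_center_iff.mp (genPow_mem_center hq (Sum.inr i)), mul_comm]
      exact ordered_mul_Y_pow i q f

/-- The algebra structure over the central polynomial subring. -/
@[reducible] noncomputable def powAlgebra :
    Algebra (MvPolynomial (Fin n ⊕ Fin n) F) (WeylAlgebra F n) :=
  (powHom hq).toRingHom.toAlgebra' fun c a =>
    (Subring.mem_center_iff.mp (powHom_mem_center hq c) a).symm

theorem sum_powHom_mul_ordered (c : (Fin n ⊕ Fin n → Fin q) → MvPolynomial (Fin n ⊕ Fin n) F) :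
    ∑ r, powHom hq (c r) * ordered (monomial (residue r) 1) =
      ordered (∑ r, expand q (c r) * monomial (residue r) 1) := by
  simp only [powHom_mul_ordered, map_sum]

theorem nonempty_powBasis (hpos : 0 < q) :
    letI := powAlgebra (n := n) hq
    Nonempty (Module.Basis (Fin n ⊕ Fin n → Fin q) (MvPolynomial (Fin n ⊕ Fin n) F)
      (WeylAlgebra F n)) := by
  let := powAlgebra (n := n) hq
  let T : ((Fin n ⊕ Fin n → Fin q) → MvPolynomial (Fin n ⊕ Fin n) F) →ₗ[
      MvPolynomial (Fin n ⊕ Fin n) F] WeylAlgebra F n :=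
    Fintype.linearCombination (MvPolynomial (Fin n ⊕ Fin n) F)
      fun r => ordered (monomial (residue r) 1)
  have hT (c) : T c = ordered (∑ r, expand q (c r) * monomial (residue r) 1) := by
    rw [← sum_powHom_mul_ordered hq]
    rfl
  have hinj : Function.Injective T := by
    rw [← LinearMap.ker_eq_bot, LinearMap.ker_eq_bot']
    intro c hc
    rw [hT, ← map_zero ordered] at hc
    funext r
    ext d
    rw [← coeff_sum_expand_mul_monomial hpos, ordered_injective hc]
    simp
  have hsurj : Function.Surjective T := by
    intro a
    obtain ⟨f, rfl⟩ := ordered_surjective a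
    obtain ⟨c, rfl⟩ := exists_eq_sum_expand_mul_monomial hpos f
    exact ⟨c, hT c⟩
  exact ⟨.ofEquivFun (LinearEquiv.ofBijective T ⟨hinj, hsurj⟩).symm⟩

theorem powHom_mem_nonZeroDivisors (hpos : 0 < q) {t : MvPolynomial (Fin n ⊕ Fin n) F}
    (ht : t ∈ nonZeroDivisors (MvPolynomial (Fin n ⊕ Fin n) F)) :
    powHom hq t ∈ nonZeroDivisors (WeylAlgebra F n) := by
  let := powAlgebra (n := n) hq
  obtain ⟨B⟩ := nonempty_powBasis (n := n) hq hpos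
  exact algebraMap_mem_nonZeroDivisors_of_basis B ht

theorem exists_mul_eq_powHom (hpos : 0 < q) {s : WeylAlgebra F n}
    (hs : s ∈ nonZeroDivisors (WeylAlgebra F n)) :
    ∃ b, ∃ t ∈ nonZeroDivisors (MvPolynomial (Fin n ⊕ Fin n) F), b * s = powHom hq t := by
  let := powAlgebra (n := n) hq
  obtain ⟨B⟩ := nonempty_powBasis (n := n) hq hpos
  exact exists_mul_eq_algebraMap_of_basis B hs.2

theorem powHom_injective (hpos : 0 < q) :
    Function.Injective (powHom (n := n) hq) := by
  intro c d h
  have h1 := powHom_mul_ordered hq c 1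
  rw [h, powHom_mul_ordered, ordered_injective.eq_iff, mul_one, mul_one] at h1
  exact expand_injective hpos h1.symm

end WeylAlgebra

section CentralLocalization

open OreLocalization nonZeroDivisors

theorem self_subset_divClosure {D : Type*} [Ring D] (S : Set D) : S ⊆ divClosure S :=
  fun _ hx => Subring.mem_sInf.mpr fun _ hT => hT.1 hx

theorem inv_mem_divClosure {D : Type*} [Ring D] {S : Set D} {x y : D} (hx : x ∈ divClosure S)
    (hxy : x * y = 1) (hyx : y * x = 1) : y ∈ divClosure S :=
  Subring.mem_sInf.mpr fun T hT => hT.2 x (Subring.mem_sInf.mp hx T hT) y hxy hyx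

theorem divClosure_le {D : Type*} [Ring D] {S : Set D} {T : Subring D} (hS : S ⊆ T)
    (hT : ∀ x ∈ T, ∀ y : D, x * y = 1 → y * x = 1 → y ∈ T) : divClosure S ≤ T :=
  sInf_le ⟨hS, hT⟩

variable {A R : Type*} [Ring A] [CommRing R] [OreSet A⁰]

theorem isUnit_numeratorRingHom {s : A} (hs : s ∈ A⁰) :
    IsUnit (numeratorRingHom s : OreLocalization A⁰ A) :=
  numerator_isUnit (⟨s, hs⟩ : A⁰)

theorem numeratorRingHom_mul_oreDiv (r : A) (s : A⁰) :
    (numeratorRingHom (s : A) * (r /ₒ s) : OreLocalization A⁰ A) = numeratorRingHom r := by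
  change ((s : A) /ₒ 1) * (r /ₒ s) = r /ₒ 1
  exact OreLocalization.mul_cancel

theorem numeratorRingHom_injective :
    Function.Injective (numeratorRingHom : A →+* OreLocalization A⁰ A) :=
  numeratorHom_inj inf_le_left

theorem exists_numeratorRingHom_mul_eq {φ : R →+* A}
    (hden : ∀ s ∈ A⁰, ∃ b, ∃ t ∈ R⁰, b * s = φ t) (d : OreLocalization A⁰ A) :
    ∃ t ∈ R⁰, ∃ a, numeratorRingHom (φ t) * d = numeratorRingHom a := by
  induction d using OreLocalization.ind with | _ r s
  obtain ⟨b, t, ht, h⟩ := hden s s.2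
  exact ⟨t, ht, b * r, by rw [← h, map_mul, mul_assoc, numeratorRingHom_mul_oreDiv, map_mul]⟩

theorem numeratorRingHom_mem_center {z : A} (hz : z ∈ Subring.center A) :
    (numeratorRingHom z : OreLocalization A⁰ A) ∈ Subring.center (OreLocalization A⁰ A) := by
  rw [Subring.mem_center_iff] at hz ⊢
  intro d
  induction d using OreLocalization.ind with | _ r s
  apply (isUnit_numeratorRingHom s.2).mul_left_cancel
  rw [← mul_assoc, numeratorRingHom_mul_oreDiv, ← map_mul, hz r, ← mul_assoc, ← map_mul,
    hz (s : A), map_mul, map_mul, mul_assoc, numeratorRingHom_mul_oreDiv]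

theorem mem_center_of_numeratorRingHom_mem_center {a : A}
    (h : (numeratorRingHom a : OreLocalization A⁰ A) ∈ Subring.center (OreLocalization A⁰ A)) :
    a ∈ Subring.center A := by
  rw [Subring.mem_center_iff] at h ⊢
  intro b
  apply numeratorRingHom_injective
  rw [map_mul, map_mul, h]

/-- The fractions inside the localization whose numerators and denominators come from a central
subring. -/
def centralFractions (φ : R →+* A) (hcen : ∀ r, φ r ∈ Subring.center A) :
    Subring (OreLocalization A⁰ A) where
  carrier := {d | ∃ t ∈ R⁰, ∃ c, numeratorRingHom (φ t) * d = numeratorRingHom (φ c)}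
  mul_mem' := by
    rintro x y ⟨t, ht, c, hx⟩ ⟨u, hu, e, hy⟩
    refine ⟨t * u, mul_mem ht hu, c * e, ?_⟩
    have := Subring.mem_center_iff.mp (numeratorRingHom_mem_center (hcen u)) x
    rw [map_mul, map_mul, map_mul, map_mul, ← hx, ← hy, mul_assoc, mul_assoc, ← mul_assoc x, this,
      mul_assoc]
  one_mem' := ⟨1, one_mem _, 1, by simp⟩
  add_mem' := by
    rintro x y ⟨t, ht, c, hx⟩ ⟨u, hu, e, hy⟩
    refine ⟨t * u, mul_mem ht hu, u * c + t * e, ?_⟩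
    have hcomm := Subring.mem_center_iff.mp
      (numeratorRingHom_mem_center (hcen u)) (numeratorRingHom (φ t))
    simp only [map_add, map_mul, ← hx, ← hy, mul_add, ← mul_assoc, hcomm]
  zero_mem' := ⟨1, one_mem _, 0, by simp⟩
  neg_mem' := by
    rintro x ⟨t, ht, c, hx⟩
    exact ⟨t, ht, -c, by rw [mul_neg, hx, map_neg, map_neg]⟩

theorem numeratorRingHom_mem_centralFractions {φ : R →+* A}
    (hcen : ∀ r, φ r ∈ Subring.center A) (c : R) :
    numeratorRingHom (φ c) ∈ centralFractions φ hcen :=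
  ⟨1, one_mem _, c, by simp⟩

theorem inv_mem_centralFractions {φ : R →+* A} {hcen : ∀ r, φ r ∈ Subring.center A}
    (hinj : Function.Injective φ) {x y : OreLocalization A⁰ A}
    (hx : x ∈ centralFractions φ hcen) (hxy : x * y = 1) : y ∈ centralFractions φ hcen := by
  obtain ⟨t, ht, c, h⟩ := hx
  have hc : numeratorRingHom (φ c) * y = numeratorRingHom (φ t) := by
    rw [← h, mul_assoc, hxy, mul_one]
  refine ⟨c, mem_nonZeroDivisors_iff_right.mpr fun e he => ?_, t, hc⟩
  refine mem_nonZeroDivisors_iff_right.mp ht e (hinj (numeratorRingHom_injective ?_))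
  rw [map_mul, map_mul, ← hc, ← mul_assoc, ← map_mul, ← map_mul, he, map_zero, map_zero, zero_mul]

theorem centralFractions_le_center {φ : R →+* A} (hcen : ∀ r, φ r ∈ Subring.center A)
    (hreg : ∀ t ∈ R⁰, φ t ∈ A⁰) :
    centralFractions φ hcen ≤ Subring.center (OreLocalization A⁰ A) := by
  rintro x ⟨t, ht, c, h⟩
  have ht' := Subring.mem_center_iff.mp (numeratorRingHom_mem_center (hcen t))
  have hc' := Subring.mem_center_iff.mp (numeratorRingHom_mem_center (hcen c))
  rw [Subring.mem_center_iff]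
  intro d
  apply (isUnit_numeratorRingHom (hreg t ht)).mul_left_cancel
  rw [← mul_assoc, ← ht', mul_assoc, h, ← mul_assoc, h, hc']

theorem exists_common_denominator {φ : R →+* A} {hcen : ∀ r, φ r ∈ Subring.center A}
    {ι : Type*} [Fintype ι] (d : ι → OreLocalization A⁰ A)
    (hd : ∀ i, d i ∈ centralFractions φ hcen) :
    ∃ t ∈ R⁰, ∃ c : ι → R, ∀ i, numeratorRingHom (φ t) * d i = numeratorRingHom (φ (c i)) := by
  choose t ht c hc using hd
  refine ⟨∏ i, t i, prod_mem fun i _ => ht i, ?_⟩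
  choose u hu using fun i => Finset.dvd_prod_of_mem t (Finset.mem_univ i)
  refine ⟨fun i => u i * c i, fun i => ?_⟩
  rw [hu i, mul_comm, map_mul, map_mul, map_mul, map_mul, ← hc, mul_assoc]

end CentralLocalization

section TruncatedCoefficients

open MvPolynomial

theorem truncWitt_natCast_pow_eq_zero {p : ℕ} [Fact p.Prime] {k : Type*} [CommRing k] (m : ℕ) :
    (p : TruncWitt p k m) ^ m = 0 := by
  have : Ideal.Quotient.mk (Ideal.span {(p : WittVector p k) ^ m}) ((p : WittVector p k) ^ m) = 0 :=
    Ideal.Quotient.eq_zero_iff_mem.mpr (Ideal.mem_span_singleton_self _)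
  rw [map_pow, map_natCast] at this
  exact this

theorem truncWitt_exists_eq_mul {p : ℕ} [Fact p.Prime] {k : Type*} [CommRing k] [IsDomain k]
    [CharP k p] {m s : ℕ} (hs : s ≤ m) {c : TruncWitt p k m}
    (hc : (p : TruncWitt p k m) ^ s * c = 0) :
    (p : TruncWitt p k m) ^ (m - s) ∣ c := by
  let π := Ideal.Quotient.mk (Ideal.span {(p : WittVector p k) ^ m})
  obtain ⟨w, rfl⟩ : ∃ w, π w = c := Ideal.Quotient.mk_surjective c
  have h : π ((p : WittVector p k) ^ s * w) = 0 := by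
    rw [map_mul, map_pow, map_natCast]
    exact hc
  obtain ⟨d, hd⟩ := Ideal.mem_span_singleton.mp (Ideal.Quotient.eq_zero_iff_mem.mp h)
  rw [← Nat.add_sub_cancel' hs, pow_add, mul_assoc] at hd
  have hw := mul_left_cancel₀ (pow_ne_zero s (WittVector.p_nonzero p k)) hd
  refine ⟨π d, ?_⟩
  rw [hw, map_mul, map_pow, map_natCast]
  rfl

variable {n : ℕ}

theorem sExp_le (p m : ℕ) (α β : Fin n → ℕ) : sExp p m α β ≤ m := Nat.findGreatest_le m

theorem pow_sExp_dvd (p m : ℕ) (α β : Fin n → ℕ) (i : Fin n) :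
    p ^ sExp p m α β ∣ α i ∧ p ^ sExp p m α β ∣ β i :=
  Nat.findGreatest_spec (P := fun s => ∀ i, p ^ s ∣ α i ∧ p ^ s ∣ β i) (Nat.zero_le m)
    (fun i => by simp) i

theorem pow_sExp_mul_eq_zero {p m : ℕ} (hp : p.Prime) {F : Type*} [CommRing F]
    (hF : (p : F) ^ m = 0) {α β : Fin n → ℕ} {c : F} (hα : ∀ i, (α i : F) * c = 0)
    (hβ : ∀ i, (β i : F) * c = 0) : (p : F) ^ sExp p m α β * c = 0 := by
  have hdvd {z : ℕ} (hz : (z : F) * c = 0) : addOrderOf c ∣ z :=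
    addOrderOf_dvd_of_nsmul_eq_zero (by rw [nsmul_eq_mul, hz])
  obtain ⟨t, htm, ht⟩ := (Nat.dvd_prime_pow hp).mp
    (hdvd (z := p ^ m) (by rw [Nat.cast_pow, hF, zero_mul]))
  have hle : t ≤ sExp p m α β :=
    Nat.le_findGreatest htm fun i => by
      rw [← ht]
      exact ⟨hdvd (hα i), hdvd (hβ i)⟩
  have h0 : ((p ^ sExp p m α β : ℕ) : F) * c = 0 := by
    rw [← nsmul_eq_mul]
    exact addOrderOf_dvd_iff_nsmul_eq_zero.mp (ht ▸ pow_dvd_pow p hle)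
  rwa [Nat.cast_pow] at h0

end TruncatedCoefficients

section CentralMonomials

open MvPolynomial WeylAlgebra OreLocalization nonZeroDivisors

variable {n m p : ℕ} {F : Type*} [CommRing F]

/-- The largest power of `p`, at most `p ^ m`, dividing the entries of an exponent vector. -/
abbrev resExp (p m : ℕ) (r : Fin n ⊕ Fin n → Fin (p ^ m)) : ℕ :=
  sExp p m (fun i => (r (Sum.inl i) : ℕ)) (fun i => (r (Sum.inr i) : ℕ))

/-- The polynomial `p ^ (m - s) x^α y^β`, whose normal ordering is central. -/
noncomputable def vPoly (F : Type*) [CommRing F] (r : Fin n ⊕ Fin n → Fin (p ^ m)) :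
    MvPolynomial (Fin n ⊕ Fin n) F :=
  monomial (residue r) ((p : F) ^ (m - resExp p m r))

theorem pow_resExp_dvd (r : Fin n ⊕ Fin n → Fin (p ^ m)) (j : Fin n ⊕ Fin n) :
    p ^ resExp p m r ∣ (r j : ℕ) := by
  rcases j with i | i
  · exact (pow_sExp_dvd p m (fun i => (r (Sum.inl i) : ℕ)) (fun i => (r (Sum.inr i) : ℕ)) i).1
  · exact (pow_sExp_dvd p m (fun i => (r (Sum.inl i) : ℕ)) (fun i => (r (Sum.inr i) : ℕ)) i).2

theorem powHom_mul_ordered_vPoly (hq : ((p ^ m : ℕ) : F) = 0)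
    (c : MvPolynomial (Fin n ⊕ Fin n) F) (r : Fin n ⊕ Fin n → Fin (p ^ m)) :
    ordered (expand (p ^ m) (C ((p : F) ^ (m - resExp p m r)) * c) * monomial (residue r) 1) =
      powHom hq c * ordered (vPoly F r) := by
  rw [powHom_mul_ordered, map_mul (expand _), expand_C, vPoly, mul_comm (C _), mul_assoc,
    C_mul_monomial, mul_one]

theorem ordered_vPoly_mem_center (hF : (p : F) ^ m = 0) (r : Fin n ⊕ Fin n → Fin (p ^ m)) :
    ordered (vPoly F r) ∈ Subring.center (WeylAlgebra F n) := by
  rw [ordered_mem_center_iff]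
  intro j
  obtain ⟨z, hz⟩ := pow_resExp_dvd r j
  rw [vPoly, pderiv_monomial, residue_apply, hz, Nat.cast_mul, Nat.cast_pow, ← mul_assoc, ← pow_add,
    Nat.sub_add_cancel (sExp_le p m _ _), hF, zero_mul, monomial_zero]

theorem pow_resExp_mul_ordered_vPoly (hF : (p : F) ^ m = 0) (r : Fin n ⊕ Fin n → Fin (p ^ m)) :
    (p : WeylAlgebra F n) ^ resExp p m r * ordered (vPoly F r) = 0 := by
  have : (p : WeylAlgebra F n) ^ resExp p m r = algebraMap F _ ((p : F) ^ resExp p m r) := by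
    rw [map_pow, map_natCast]
  rw [this, ← Algebra.smul_def, ← map_smul, vPoly, smul_monomial, smul_eq_mul, ← pow_add,
    Nat.add_sub_cancel' (sExp_le p m _ _), hF, monomial_zero, map_zero]

theorem exists_eq_sum_powHom_mul_vPoly (hp : p.Prime) (hF : (p : F) ^ m = 0)
    (hq : ((p ^ m : ℕ) : F) = 0)
    (hdiv : ∀ s ≤ m, ∀ c : F, (p : F) ^ s * c = 0 → (p : F) ^ (m - s) ∣ c)
    {a : WeylAlgebra F n} (ha : a ∈ Subring.center (WeylAlgebra F n)) :
    ∃ d : (Fin n ⊕ Fin n → Fin (p ^ m)) → MvPolynomial (Fin n ⊕ Fin n) F,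
      a = ∑ r, powHom hq (d r) * ordered (vPoly F r) := by
  obtain ⟨f, rfl⟩ := ordered_surjective a
  rw [ordered_mem_center_iff] at ha
  have hpos : 0 < p ^ m := pow_pos hp.pos m
  obtain ⟨c, hc⟩ := exists_eq_sum_expand_mul_monomial hpos f
  have hzero (e : Fin n ⊕ Fin n →₀ ℕ) (j) : (e j : F) * coeff e f = 0 := by
    obtain h0 | h0 := Nat.eq_zero_or_pos (e j)
    · rw [h0, Nat.cast_zero, zero_mul]
    · have h1 := coeff_pderiv (i := j) f (e - Finsupp.single j 1)
      rw [ha, coeff_zero, Finsupp.tsub_apply, Finsupp.single_eq_same, ← Nat.cast_add_one,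
        Nat.sub_add_cancel h0, tsub_add_cancel_of_le (Finsupp.single_le_iff.mpr h0)] at h1
      rw [mul_comm, ← h1]
  have hdvd (r) : C ((p : F) ^ (m - resExp p m r)) ∣ c r := by
    rw [C_dvd_iff_dvd_coeff]
    intro e
    have hr (j) : ((r j : ℕ) : F) * coeff e (c r) = 0 := by
      have := hzero (p ^ m • e + residue r) j
      rw [hc, coeff_sum_expand_mul_monomial hpos, Finsupp.add_apply, Finsupp.smul_apply,
        residue_apply, smul_eq_mul, Nat.cast_add, Nat.cast_mul, hq, zero_mul, zero_add] at this
      exact this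
    exact hdiv _ (sExp_le p m _ _) _
      (pow_sExp_mul_eq_zero hp hF (fun i => hr (Sum.inl i)) fun i => hr (Sum.inr i))
  choose d hd using hdvd
  refine ⟨d, ?_⟩
  rw [hc, map_sum]
  refine Finset.sum_congr rfl fun r _ => ?_
  rw [hd, powHom_mul_ordered_vPoly hq]

theorem pow_dvd_of_sum_powHom_mul_vPoly_eq_zero (hp : p.Prime) (hq : ((p ^ m : ℕ) : F) = 0)
    (hdiv : ∀ s ≤ m, ∀ c : F, (p : F) ^ s * c = 0 → (p : F) ^ (m - s) ∣ c)
    {c : (Fin n ⊕ Fin n → Fin (p ^ m)) → MvPolynomial (Fin n ⊕ Fin n) F}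
    (hc : ∑ r, powHom hq (c r) * ordered (vPoly F r) = 0) (r : Fin n ⊕ Fin n → Fin (p ^ m)) :
    C ((p : F) ^ resExp p m r) ∣ c r := by
  have hpos : 0 < p ^ m := pow_pos hp.pos m
  have h : ordered (∑ r, expand (p ^ m) (C ((p : F) ^ (m - resExp p m r)) * c r) *
      monomial (residue r) 1) = 0 := by
    rw [← hc, map_sum]
    refine Finset.sum_congr rfl fun r _ => ?_
    exact powHom_mul_ordered_vPoly hq _ r
  rw [← map_zero ordered, ordered_injective.eq_iff] at h
  rw [C_dvd_iff_dvd_coeff]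
  intro e
  have he := coeff_sum_expand_mul_monomial hpos
    (fun r => C ((p : F) ^ (m - resExp p m r)) * c r) e r
  rw [h, coeff_zero, coeff_C_mul] at he
  have := hdiv _ (Nat.sub_le _ _) _ he.symm
  rwa [Nat.sub_sub_self (sExp_le p m _ _)] at this

theorem prod_ofFn_X_pow (α : Fin n →₀ ℕ) :
    (List.ofFn fun i => (X i : WeylAlgebra F n) ^ α i).prod = xHom (monomial α 1) := by
  have h : monomial α (1 : F) = (List.ofFn fun i => MvPolynomial.X i ^ α i).prod := by
    rw [List.prod_ofFn, monomial_eq, C_1, one_mul, Finsupp.prod_fintype _ _ fun _ => pow_zero _]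
  rw [h, map_list_prod, List.map_ofFn]
  simp [Function.comp_def]

theorem prod_ofFn_Y_pow (α : Fin n →₀ ℕ) :
    (List.ofFn fun i => (Y i : WeylAlgebra F n) ^ α i).prod = yHom (monomial α 1) := by
  have h : monomial α (1 : F) = (List.ofFn fun i => MvPolynomial.X i ^ α i).prod := by
    rw [List.prod_ofFn, monomial_eq, C_1, one_mul, Finsupp.prod_fintype _ _ fun _ => pow_zero _]
  rw [h, map_list_prod, List.map_ofFn]
  simp [Function.comp_def]

theorem ordered_vPoly (r : Fin n ⊕ Fin n → Fin (p ^ m)) :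
    ordered (vPoly F r) = (p : WeylAlgebra F n) ^ (m - resExp p m r) *
      (List.ofFn fun i => (X i : WeylAlgebra F n) ^ (r (Sum.inl i) : ℕ)).prod *
      (List.ofFn fun i => (Y i : WeylAlgebra F n) ^ (r (Sum.inr i) : ℕ)).prod := by
  rw [vPoly, ordered_monomial, ← prod_ofFn_X_pow, ← prod_ofFn_Y_pow, Algebra.smul_def, map_pow,
    map_natCast, mul_assoc]
  rfl

end CentralMonomials

section Center

open MvPolynomial WeylAlgebra OreLocalization nonZeroDivisors

theorem truncWitt_natCast_eq_zero : ((p ^ m : ℕ) : TruncWitt p k m) = 0 := by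
  rw [Nat.cast_pow, truncWitt_natCast_pow_eq_zero]

/-- The embedding of polynomials in the `p ^ m`-th powers of the generators. -/
noncomputable abbrev powRingHom :
    MvPolynomial (Fin n ⊕ Fin n) (TruncWitt p k m) →+* WeylAlgebra (TruncWitt p k m) n :=
  (powHom (truncWitt_natCast_eq_zero p m k)).toRingHom

theorem powRingHom_mem_center (c : MvPolynomial (Fin n ⊕ Fin n) (TruncWitt p k m)) :
    powRingHom p n m k c ∈ Subring.center (WeylAlgebra (TruncWitt p k m) n) :=
  powHom_mem_center _ c

theorem prime_pow_pos : 0 < p ^ m := pow_pos (Fact.out : p.Prime).pos m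

theorem powRingHom_injective : Function.Injective (powRingHom p n m k) :=
  powHom_injective _ (prime_pow_pos p m)

theorem powRingHom_mem_nonZeroDivisors
    (t : MvPolynomial (Fin n ⊕ Fin n) (TruncWitt p k m)) (ht : t ∈ nonZeroDivisors _) :
    powRingHom p n m k t ∈ nonZeroDivisors (WeylAlgebra (TruncWitt p k m) n) :=
  powHom_mem_nonZeroDivisors _ (prime_pow_pos p m) ht

theorem numeratorRingHom_powRingHom_mem_Km
    (c : MvPolynomial (Fin n ⊕ Fin n) (TruncWitt p k m)) :
    numeratorRingHom (powRingHom p n m k c) ∈ Km p n m k := by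
  induction c using MvPolynomial.induction_on with
  | C r =>
    refine self_subset_divClosure _ (Or.inl (Or.inl ⟨r, ?_⟩))
    exact congrArg numeratorRingHom ((powHom (truncWitt_natCast_eq_zero p m k)).commutes r).symm
  | add c d hc hd => rw [map_add, map_add]; exact add_mem hc hd
  | mul_X c j hc =>
    rw [map_mul, map_mul]
    refine mul_mem hc (self_subset_divClosure _ ?_)
    have hj : powRingHom p n m k (MvPolynomial.X j) = genPow (p ^ m) j := powHom_X _ j
    rw [hj]
    rcases j with i | i
    · exact Or.inl (Or.inr ⟨i, (map_pow numeratorRingHom _ _).symm⟩)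
    · exact Or.inr ⟨i, (map_pow numeratorRingHom _ _).symm⟩

theorem Km_eq_centralFractions :
    Km p n m k = centralFractions (powRingHom p n m k) (powRingHom_mem_center p n m k) := by
  apply le_antisymm
  · refine divClosure_le ?_ fun x hx y hxy _ =>
      inv_mem_centralFractions (powRingHom_injective p n m k) hx hxy
    rintro _ ((⟨r, rfl⟩ | ⟨i, rfl⟩) | ⟨i, rfl⟩)
    · refine Set.mem_of_eq_of_mem ?_ (numeratorRingHom_mem_centralFractions
        (powRingHom_mem_center p n m k) (MvPolynomial.C r))
      exact congrArg numeratorRingHom ((powHom (truncWitt_natCast_eq_zero p m k)).commutes r).symm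
    · refine Set.mem_of_eq_of_mem ?_ (numeratorRingHom_mem_centralFractions
        (powRingHom_mem_center p n m k) (MvPolynomial.X (Sum.inl i)))
      have hi : powRingHom p n m k (MvPolynomial.X (Sum.inl i)) = genPow (p ^ m) (Sum.inl i) :=
        powHom_X _ _
      rw [hi]
      exact (map_pow numeratorRingHom _ _).symm
    · refine Set.mem_of_eq_of_mem ?_ (numeratorRingHom_mem_centralFractions
        (powRingHom_mem_center p n m k) (MvPolynomial.X (Sum.inr i)))
      have hi : powRingHom p n m k (MvPolynomial.X (Sum.inr i)) = genPow (p ^ m) (Sum.inr i) :=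
        powHom_X _ _
      rw [hi]
      exact (map_pow numeratorRingHom _ _).symm
  · rintro x ⟨t, ht, c, hx⟩
    obtain ⟨u, hu⟩ := isUnit_numeratorRingHom (powRingHom_mem_nonZeroDivisors p n m k t ht)
    have hinv : (↑u⁻¹ : WeylLoc (TruncWitt p k m) n) ∈ Km p n m k :=
      inv_mem_divClosure (hu ▸ numeratorRingHom_powRingHom_mem_Km p n m k t) u.mul_inv u.inv_mul
    rw [← hu] at hx
    rw [← u.inv_mul_cancel_left x, hx]
    exact mul_mem hinv (numeratorRingHom_powRingHom_mem_Km p n m k c)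

theorem Km_le_center : Km p n m k ≤ Subring.center (WeylLoc (TruncWitt p k m) n) := by
  rw [Km_eq_centralFractions]
  exact centralFractions_le_center _ (powRingHom_mem_nonZeroDivisors p n m k)

theorem vElt_eq (r : Fin n ⊕ Fin n → Fin (p ^ m)) :
    vElt p n m k (fun i => r (Sum.inl i)) (fun i => r (Sum.inr i)) =
      numeratorRingHom (ordered (vPoly (TruncWitt p k m) r)) := by
  rw [ordered_vPoly, map_mul, map_mul, map_pow, map_natCast, map_list_prod, map_list_prod,
    List.map_ofFn, List.map_ofFn]
  simp only [Function.comp_def, map_pow]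
  rfl

theorem vElt_mem_center (α β : Fin n → Fin (p ^ m)) :
    vElt p n m k α β ∈ Subring.center (WeylLoc (TruncWitt p k m) n) := by
  have := vElt_eq p n m k (Sum.elim α β)
  simp only [Sum.elim_inl, Sum.elim_inr] at this
  rw [this]
  exact numeratorRingHom_mem_center
    (ordered_vPoly_mem_center (truncWitt_natCast_pow_eq_zero m) _)

theorem pow_sExp_mul_vElt (α β : Fin n → Fin (p ^ m)) :
    (p : WeylLoc (TruncWitt p k m) n) ^
      (sExp p m (fun i => (α i : ℕ)) (fun i => (β i : ℕ))) * vElt p n m k α β = 0 := by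
  have h := vElt_eq p n m k (Sum.elim α β)
  have h' := congrArg (numeratorRingHom : _ →+* WeylLoc (TruncWitt p k m) n)
    (pow_resExp_mul_ordered_vPoly (truncWitt_natCast_pow_eq_zero (p := p) (k := k) m)
      (Sum.elim α β))
  rwa [map_mul, map_pow, map_natCast, map_zero, ← h] at h'

theorem mem_span_of_mem_center {d : WeylLoc (TruncWitt p k m) n}
    (hd : d ∈ Subring.center (WeylLoc (TruncWitt p k m) n)) :
    d ∈ Submodule.span (Km p n m k) {w : WeylLoc (TruncWitt p k m) n |
      ∃ α β : Fin n → Fin (p ^ m),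
        0 < sExp p m (fun i => (α i : ℕ)) (fun i => (β i : ℕ)) ∧ w = vElt p n m k α β} := by
  obtain ⟨t, ht, a, ha⟩ := exists_numeratorRingHom_mul_eq (φ := powRingHom p n m k)
    (fun s hs => exists_mul_eq_powHom _ (prime_pow_pos p m) hs) d
  have hcen : a ∈ Subring.center (WeylAlgebra (TruncWitt p k m) n) := by
    apply mem_center_of_numeratorRingHom_mem_center
    rw [← ha]
    exact mul_mem (numeratorRingHom_mem_center (powRingHom_mem_center p n m k t)) hd
  obtain ⟨c, rfl⟩ := exists_eq_sum_powHom_mul_vPoly (Fact.out : p.Prime)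
    (truncWitt_natCast_pow_eq_zero m) (truncWitt_natCast_eq_zero p m k)
    (fun s hs c hc => truncWitt_exists_eq_mul hs hc) hcen
  obtain ⟨u, hu⟩ := isUnit_numeratorRingHom (powRingHom_mem_nonZeroDivisors p n m k t ht)
  have hinv : (↑u⁻¹ : WeylLoc (TruncWitt p k m) n) ∈ Km p n m k :=
    inv_mem_divClosure (hu ▸ numeratorRingHom_powRingHom_mem_Km p n m k t) u.mul_inv u.inv_mul
  rw [← hu] at ha
  rw [← u.inv_mul_cancel_left d, ha]
  refine Submodule.smul_mem _ (⟨_, hinv⟩ : Km p n m k) ?_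
  rw [map_sum]
  refine Submodule.sum_mem _ fun r _ => ?_
  rw [map_mul, ← vElt_eq]
  refine Submodule.smul_mem _
    (⟨_, numeratorRingHom_powRingHom_mem_Km p n m k (c r)⟩ : Km p n m k) ?_
  obtain h0 | h0 := Nat.eq_zero_or_pos (resExp p m r)
  · have := pow_sExp_mul_vElt p n m k (fun i => r (Sum.inl i)) (fun i => r (Sum.inr i))
    rw [show sExp p m (fun i => (r (Sum.inl i) : ℕ)) (fun i => (r (Sum.inr i) : ℕ)) = 0 from h0,
      pow_zero, one_mul] at this
    rw [this]
    exact Submodule.zero_mem _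
  · exact Submodule.subset_span ⟨_, _, h0, rfl⟩

theorem mem_center_of_mem_span {d : WeylLoc (TruncWitt p k m) n}
    (hd : d ∈ Submodule.span (Km p n m k) {w : WeylLoc (TruncWitt p k m) n |
      ∃ α β : Fin n → Fin (p ^ m),
        0 < sExp p m (fun i => (α i : ℕ)) (fun i => (β i : ℕ)) ∧ w = vElt p n m k α β}) :
    d ∈ Subring.center (WeylLoc (TruncWitt p k m) n) := by
  induction hd using Submodule.span_induction with
  | mem x hx =>
    obtain ⟨α, β, -, rfl⟩ := hx
    exact vElt_mem_center p n m k α β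
  | zero => exact zero_mem _
  | add x y _ _ hx hy => exact add_mem hx hy
  | smul a x _ hx => exact mul_mem (Km_le_center p n m k a.2) hx

theorem exists_eq_pow_mul_of_sum_mul_vElt_eq_zero
    (c : (Fin n ⊕ Fin n → Fin (p ^ m)) → WeylLoc (TruncWitt p k m) n)
    (hc : ∀ r, c r ∈ Km p n m k)
    (h : ∑ r, c r * vElt p n m k (fun i => r (Sum.inl i)) (fun i => r (Sum.inr i)) = 0)
    (r : Fin n ⊕ Fin n → Fin (p ^ m)) :
    ∃ d ∈ Km p n m k, c r = (p : WeylLoc (TruncWitt p k m) n) ^ resExp p m r * d := by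
  simp only [Km_eq_centralFractions] at hc
  obtain ⟨t, ht, e, he⟩ := exists_common_denominator c hc
  have hsum : ∑ r, powHom (truncWitt_natCast_eq_zero p m k) (e r) *
      ordered (vPoly (TruncWitt p k m) r) = 0 := by
    apply numeratorRingHom_injective
    rw [map_zero, ← mul_zero (numeratorRingHom (powRingHom p n m k t)), ← h, Finset.mul_sum,
      map_sum]
    refine Finset.sum_congr rfl fun r _ => ?_
    rw [map_mul, vElt_eq, ← mul_assoc, he]
    rfl
  obtain ⟨z, hz⟩ := pow_dvd_of_sum_powHom_mul_vPoly_eq_zero (Fact.out : p.Prime)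
    (truncWitt_natCast_eq_zero p m k) (fun s hs c hc => truncWitt_exists_eq_mul hs hc) hsum r
  obtain ⟨u, hu⟩ := isUnit_numeratorRingHom (powRingHom_mem_nonZeroDivisors p n m k t ht)
  have hinv : (↑u⁻¹ : WeylLoc (TruncWitt p k m) n) ∈ Km p n m k :=
    inv_mem_divClosure (hu ▸ numeratorRingHom_powRingHom_mem_Km p n m k t) u.mul_inv u.inv_mul
  refine ⟨↑u⁻¹ * numeratorRingHom (powRingHom p n m k z),
    mul_mem hinv (numeratorRingHom_powRingHom_mem_Km p n m k z), ?_⟩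
  have hr := he r
  rw [← hu, hz, map_pow, map_natCast, map_mul, map_mul, map_pow, map_pow, map_natCast,
    map_natCast] at hr
  have hcomm : Commute ((p : WeylLoc (TruncWitt p k m) n) ^ resExp p m r) ↑u⁻¹ :=
    (Nat.cast_commute p _).pow_left _
  rw [← mul_assoc, hcomm.eq, mul_assoc, ← hr, u.inv_mul_cancel_left]

end Center

/-- Lemma (centerstr): the center `Z_m` of `D_{pᵐ}` is generated as a `K_m`-module by the
elements `v_{α,β}` (`0 ≤ αᵢ, βᵢ ≤ pᵐ − 1`, `s(α,β) > 0`); each satisfies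
`p^{s(α,β)} v_{α,β} = 0`, and these are the defining relations: any `K_m`-linear
combination of the `v_{α,β}` vanishing in `D_{pᵐ}` has all its coefficients in
`p^{s(α,β)} K_m`. -/
theorem stmt14 (hm : 0 < m) :
    (∀ α β : Fin n → Fin (p ^ m),
      vElt p n m k α β ∈ Subring.center (WeylLoc (TruncWitt p k m) n) ∧
      (p : WeylLoc (TruncWitt p k m) n) ^
          (sExp p m (fun i => (α i : ℕ)) (fun i => (β i : ℕ))) * vElt p n m k α β = 0) ∧
    (Subring.center (WeylLoc (TruncWitt p k m) n) : Set (WeylLoc (TruncWitt p k m) n)) =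
      (Submodule.span (Km p n m k)
        {w : WeylLoc (TruncWitt p k m) n |
          ∃ α β : Fin n → Fin (p ^ m),
            0 < sExp p m (fun i => (α i : ℕ)) (fun i => (β i : ℕ)) ∧
            w = vElt p n m k α β} : Set (WeylLoc (TruncWitt p k m) n)) ∧
    (∀ c : ((Fin n → Fin (p ^ m)) × (Fin n → Fin (p ^ m))) → Km p n m k,
      ∑ ab : (Fin n → Fin (p ^ m)) × (Fin n → Fin (p ^ m)),
          (c ab : WeylLoc (TruncWitt p k m) n) * vElt p n m k ab.1 ab.2 = 0 →
      ∀ ab : (Fin n → Fin (p ^ m)) × (Fin n → Fin (p ^ m)),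
        ∃ d ∈ Km p n m k, (c ab : WeylLoc (TruncWitt p k m) n) =
          (p : WeylLoc (TruncWitt p k m) n) ^
            (sExp p m (fun i => ((ab.1 i : ℕ))) (fun i => ((ab.2 i : ℕ)))) * d) := by
  refine ⟨fun α β => ⟨vElt_mem_center p n m k α β, pow_sExp_mul_vElt p n m k α β⟩,
    Set.ext fun d => ⟨mem_span_of_mem_center p n m k, mem_center_of_mem_span p n m k⟩, ?_⟩
  intro c hc ab
  let E := Equiv.sumArrowEquivProdArrow (Fin n) (Fin n) (Fin (p ^ m))
  refine exists_eq_pow_mul_of_sum_mul_vElt_eq_zero p n m k (fun r => c (E r))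
    (fun r => (c (E r)).2) ?_ (E.symm ab)
  rw [← hc]
  exact Fintype.sum_equiv E _ _ fun r => rfl

end
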